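/- (Deterministic core of Theorem 3 of the paper: total compensation under information gap.) Let d ≥ 1, λ ≥ 1, T ≥ 1, R ≥ 0, δ ∈ (0, 1]. Let v_1, …, v_T ∈ ℝ^d with ‖v_t‖₂ ≤ 1 be the features of the pulled arms, set A_1 = λI_d and A_{t+1} = A_t + v_t v_tᵀ, and define α_t = R·√(d·log((1 + t/λ)/δ)) + √λ. Then the total compensation paid by Algorithm 1, C(T) = Σ_{t=1}^{T} 4·α_t·‖v_t‖_{A_t⁻¹}, satisfies C(T) ≤ 4·(R·√(d·log((1 + T/λ)/δ)) + √λ)·√(2·T·d·log(1 + T/(λd))). -/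

import Mathlib

open Matrix

namespace Matrix

variable {n : Type*}

theorem posSemidef_vecMulVec_self [Finite n] (v : n → ℝ) : (vecMulVec v v).PosSemidef := by
  simpa using posSemidef_vecMulVec_self_star v

theorem posDef_of_posSemidef_sub_one [DecidableEq n] {A : Matrix n n ℝ} (hA : (A - 1).PosSemidef) :
    A.PosDef := by
  simpa using PosDef.one.add_posSemidef hA

variable [Fintype n] [DecidableEq n]

theorem PosDef.dotProduct_inv_mulVec_nonneg {A : Matrix n n ℝ} (hA : A.PosDef) (v : n → ℝ) :
    0 ≤ v ⬝ᵥ A⁻¹ *ᵥ v := by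
  simpa using hA.inv.posSemidef.dotProduct_mulVec_nonneg v

/-- The log-determinant of a positive definite matrix is bounded by the tangent line of the
logarithm at any `m > 0`, applied to its eigenvalues. -/
theorem PosDef.log_det_le {A : Matrix n n ℝ} (hA : A.PosDef) {m : ℝ} (hm : 0 < m) :
    Real.log A.det ≤ A.trace / m - Fintype.card n + Fintype.card n * Real.log m := by
  have hpos := hA.eigenvalues_pos
  have hdet : A.det = ∏ i, hA.1.eigenvalues i := by
    simpa using hA.1.det_eq_prod_eigenvalues
  have htr : A.trace = ∑ i, hA.1.eigenvalues i := by
    simpa using hA.1.trace_eq_sum_eigenvalues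
  rw [hdet, htr, Real.log_prod fun i _ => (hpos i).ne']
  calc ∑ i, Real.log (hA.1.eigenvalues i)
      ≤ ∑ i, (hA.1.eigenvalues i / m - 1 + Real.log m) := by
        refine Finset.sum_le_sum fun i _ => ?_
        have h := Real.log_le_sub_one_of_pos (div_pos (hpos i) hm)
        rw [Real.log_div (hpos i).ne' hm.ne'] at h
        linarith
    _ = _ := by
        simp [Finset.sum_add_distrib, Finset.sum_sub_distrib, Finset.sum_div]

/-- The matrix determinant lemma for a symmetric rank-one update. -/
theorem det_add_vecMulVec_self {A : Matrix n n ℝ} (hA : IsUnit A.det) (v : n → ℝ) :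
    (A + vecMulVec v v).det = A.det * (1 + v ⬝ᵥ A⁻¹ *ᵥ v) := by
  rw [vecMulVec_eq Unit, det_add_replicateCol_mul_replicateRow hA]
  congr 1
  rw [Matrix.mul_assoc, ← replicateCol_mulVec, det_unique]
  simp [replicateRow_mul_replicateCol_apply]

/-- If `1 ≤ A` in the Loewner order, the unit ball lies in the unit ball of `A⁻¹`. -/
theorem dotProduct_inv_mulVec_le_one {A : Matrix n n ℝ} (hA : (A - 1).PosSemidef)
    {v : n → ℝ} (hv : v ⬝ᵥ v ≤ 1) : v ⬝ᵥ A⁻¹ *ᵥ v ≤ 1 := by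
  have hu : IsUnit A.det := (posDef_of_posSemidef_sub_one hA).det_pos.ne'.isUnit
  set w := A⁻¹ *ᵥ v with hw
  have hAw : A *ᵥ w = v := by
    rw [hw, mulVec_mulVec, mul_nonsing_inv A hu, one_mulVec]
  have hww : w ⬝ᵥ w ≤ v ⬝ᵥ w := by
    have h := hA.dotProduct_mulVec_nonneg w
    rw [sub_mulVec, hAw, one_mulVec, star_trivial, dotProduct_sub, dotProduct_comm w v] at h
    linarith
  have hcs : (v ⬝ᵥ w) ^ 2 ≤ (v ⬝ᵥ v) * (w ⬝ᵥ w) := by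
    simpa [dotProduct, sq] using Finset.sum_mul_sq_le_sq_mul_sq Finset.univ v w
  have hw0 : 0 ≤ w ⬝ᵥ w := by simpa using dotProduct_star_self_nonneg w
  nlinarith

end Matrix

theorem Real.le_two_mul_log_one_add {x : ℝ} (h0 : 0 ≤ x) (h1 : x ≤ 1) :
    x ≤ 2 * Real.log (1 + x) := by
  have h := Real.le_log_one_add_of_nonneg h0
  have h2 : x / 2 ≤ 2 * x / (x + 2) := by
    rw [div_le_div_iff₀ (by norm_num) (by linarith)]
    nlinarith
  linarith

section EllipticalPotential

variable {d T : ℕ} {lam : ℝ} {v : ℕ → Fin d → ℝ} {A : ℕ → Matrix (Fin d) (Fin d) ℝ}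

theorem designMatrix_sub_one_posSemidef (hlam : 1 ≤ lam)
    (hA1 : A 1 = lam • (1 : Matrix (Fin d) (Fin d) ℝ))
    (hAs : ∀ t, 1 ≤ t → t ≤ T → A (t + 1) = A t + vecMulVec (v t) (v t))
    {t : ℕ} (ht : t ≤ T) : (A (t + 1) - 1).PosSemidef := by
  induction t with
  | zero =>
    have h := (PosSemidef.one (n := Fin d) (R := ℝ)).smul (sub_nonneg.2 hlam)
    simpa [hA1, sub_smul] using h
  | succ t ih =>
    rw [hAs (t + 1) (by omega) ht, add_sub_right_comm]
    exact (ih (by omega)).add (posSemidef_vecMulVec_self _)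

theorem designMatrix_trace_le (hv : ∀ t, 1 ≤ t → t ≤ T → v t ⬝ᵥ v t ≤ 1)
    (hA1 : A 1 = lam • (1 : Matrix (Fin d) (Fin d) ℝ))
    (hAs : ∀ t, 1 ≤ t → t ≤ T → A (t + 1) = A t + vecMulVec (v t) (v t))
    {t : ℕ} (ht : t ≤ T) : (A (t + 1)).trace ≤ lam * d + t := by
  induction t with
  | zero => simp [hA1]
  | succ t ih =>
    rw [hAs (t + 1) (by omega) ht, trace_add, trace_vecMulVec]
    have h1 := ih (by omega)
    have h2 := hv (t + 1) (by omega) ht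
    push_cast
    linarith

theorem log_det_designMatrix (hlam : 1 ≤ lam)
    (hA1 : A 1 = lam • (1 : Matrix (Fin d) (Fin d) ℝ))
    (hAs : ∀ t, 1 ≤ t → t ≤ T → A (t + 1) = A t + vecMulVec (v t) (v t))
    {t : ℕ} (ht : t ≤ T) :
    Real.log (A (t + 1)).det =
      d * Real.log lam + ∑ s ∈ Finset.Icc 1 t, Real.log (1 + v s ⬝ᵥ (A s)⁻¹ *ᵥ v s) := by
  induction t with
  | zero => simp [hA1]
  | succ t ih =>
    have hpd := posDef_of_posSemidef_sub_one
      (designMatrix_sub_one_posSemidef hlam hA1 hAs (show t ≤ T by omega))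
    have hx := hpd.dotProduct_inv_mulVec_nonneg (v (t + 1))
    rw [hAs (t + 1) (by omega) ht, det_add_vecMulVec_self hpd.det_pos.ne'.isUnit,
      Real.log_mul hpd.det_pos.ne' (by positivity), ih (by omega),
      Finset.sum_Icc_succ_top (by omega), add_assoc]

/-- The elliptical potential lemma. -/
theorem sum_dotProduct_inv_mulVec_le (hd : 1 ≤ d) (hlam : 1 ≤ lam)
    (hv : ∀ t, 1 ≤ t → t ≤ T → v t ⬝ᵥ v t ≤ 1)
    (hA1 : A 1 = lam • (1 : Matrix (Fin d) (Fin d) ℝ))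
    (hAs : ∀ t, 1 ≤ t → t ≤ T → A (t + 1) = A t + vecMulVec (v t) (v t)) :
    ∑ t ∈ Finset.Icc 1 T, v t ⬝ᵥ (A t)⁻¹ *ᵥ v t ≤
      2 * (d * Real.log (1 + T / (lam * d))) := by
  have hl : 0 < lam := by linarith
  have hd0 : (0 : ℝ) < d := by exact_mod_cast hd
  have hm : 0 < 1 + (T : ℝ) / (lam * d) := by positivity
  have hpsd := fun {t : ℕ} (ht : t ≤ T) => designMatrix_sub_one_posSemidef hlam hA1 hAs ht
  have hdet : Real.log (A (T + 1)).det ≤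
      d * Real.log lam + d * Real.log (1 + T / (lam * d)) := by
    have h := (posDef_of_posSemidef_sub_one (hpsd le_rfl)).log_det_le (mul_pos hl hm)
    have htr : (A (T + 1)).trace / (lam * (1 + T / (lam * d))) ≤ d := by
      rw [div_le_iff₀ (mul_pos hl hm)]
      refine (designMatrix_trace_le hv hA1 hAs le_rfl).trans_eq ?_
      field_simp
    rw [Fintype.card_fin, Real.log_mul hl.ne' hm.ne'] at h
    linarith
  rw [log_det_designMatrix hlam hA1 hAs le_rfl] at hdet
  calc ∑ t ∈ Finset.Icc 1 T, v t ⬝ᵥ (A t)⁻¹ *ᵥ v t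
      ≤ ∑ t ∈ Finset.Icc 1 T, 2 * Real.log (1 + v t ⬝ᵥ (A t)⁻¹ *ᵥ v t) := by
        refine Finset.sum_le_sum fun t ht => ?_
        obtain ⟨h1, hT⟩ := Finset.mem_Icc.1 ht
        obtain ⟨s, rfl⟩ : ∃ s, t = s + 1 := ⟨t - 1, by omega⟩
        have hs := hpsd (show s ≤ T by omega)
        exact Real.le_two_mul_log_one_add
          ((posDef_of_posSemidef_sub_one hs).dotProduct_inv_mulVec_nonneg _)
          (dotProduct_inv_mulVec_le_one hs (hv _ h1 hT))
    _ ≤ _ := by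
        rw [← Finset.mul_sum]
        linarith

end EllipticalPotential

/-- deterministic core of Theorem 3 of the paper (total
compensation under information gap). With `A_1 = λI`, `A_{t+1} = A_t + v_t v_tᵀ`,
`α_t = R √(d log((1 + t/λ)/δ)) + √λ`, the total compensation
`C(T) = Σ_{t=1}^T 4 α_t ‖v_t‖_{A_t⁻¹}` satisfies
`C(T) ≤ 4 (R √(d log((1 + T/λ)/δ)) + √λ) √(2 T d log(1 + T/(λ d)))`. -/
theorem total_compensation_bound_info_gap
    (d : ℕ) (hd : 1 ≤ d) (lam : ℝ) (hlam : 1 ≤ lam) (T : ℕ) (hT : 1 ≤ T)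
    (R : ℝ) (hR : 0 ≤ R) (δ : ℝ) (hδ : 0 < δ) (hδ1 : δ ≤ 1)
    (v : ℕ → Fin d → ℝ)
    (hv : ∀ t, 1 ≤ t → t ≤ T → Real.sqrt (v t ⬝ᵥ v t) ≤ 1)
    (A : ℕ → Matrix (Fin d) (Fin d) ℝ)
    (hA1 : A 1 = lam • (1 : Matrix (Fin d) (Fin d) ℝ))
    (hAs : ∀ t, 1 ≤ t → t ≤ T → A (t + 1) = A t + Matrix.vecMulVec (v t) (v t)) :
    ∑ t ∈ Finset.Icc 1 T,
        4 * (R * Real.sqrt (d * Real.log ((1 + (t : ℝ) / lam) / δ)) + Real.sqrt lam)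
          * Real.sqrt (v t ⬝ᵥ ((A t)⁻¹).mulVec (v t))
      ≤ 4 * (R * Real.sqrt (d * Real.log ((1 + (T : ℝ) / lam) / δ)) + Real.sqrt lam)
          * Real.sqrt (2 * T * d * Real.log (1 + (T : ℝ) / (lam * d))) := by
  have hl : 0 < lam := by linarith
  have hpot := sum_dotProduct_inv_mulVec_le hd hlam
    (fun t h1 hT => Real.sqrt_le_one.1 (hv t h1 hT)) hA1 hAs
  have hsum : ∑ t ∈ Finset.Icc 1 T, Real.sqrt (v t ⬝ᵥ ((A t)⁻¹).mulVec (v t)) ≤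
      Real.sqrt (2 * T * d * Real.log (1 + (T : ℝ) / (lam * d))) := by
    refine Real.le_sqrt_of_sq_le ?_
    have hcs := sq_sum_le_card_mul_sum_sq (s := Finset.Icc 1 T)
      (f := fun t => Real.sqrt (v t ⬝ᵥ ((A t)⁻¹).mulVec (v t)))
    refine hcs.trans ?_
    have hsq : ∑ t ∈ Finset.Icc 1 T, Real.sqrt (v t ⬝ᵥ ((A t)⁻¹).mulVec (v t)) ^ 2 =
        ∑ t ∈ Finset.Icc 1 T, v t ⬝ᵥ ((A t)⁻¹).mulVec (v t) := by
      refine Finset.sum_congr rfl fun t ht => Real.sq_sqrt ?_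
      obtain ⟨h1, hT⟩ := Finset.mem_Icc.1 ht
      obtain ⟨s, rfl⟩ : ∃ s, t = s + 1 := ⟨t - 1, by omega⟩
      exact (posDef_of_posSemidef_sub_one (designMatrix_sub_one_posSemidef hlam hA1 hAs
        (show s ≤ T by omega))).dotProduct_inv_mulVec_nonneg _
    rw [hsq, Nat.card_Icc, Nat.add_sub_cancel]
    calc (T : ℝ) * ∑ t ∈ Finset.Icc 1 T, v t ⬝ᵥ ((A t)⁻¹).mulVec (v t)
        ≤ T * (2 * (d * Real.log (1 + T / (lam * d)))) := by gcongr
      _ = _ := by ring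
  refine le_trans ?_ (mul_le_mul_of_nonneg_left hsum (by positivity))
  rw [Finset.mul_sum]
  refine Finset.sum_le_sum fun t ht => ?_
  have htT : (t : ℝ) ≤ T := by exact_mod_cast (Finset.mem_Icc.1 ht).2
  gcongr
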